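/- Let T be a tree of order n ≥ 9 that is not isomorphic to F_n. Then d(T) ≤ h(n), where h(n) = 2^{n−1} + (n+9)·2^{(n−7)/2} if n is odd and h(n) = 2^{n−1} + (n+12)·2^{(n−8)/2} if n is even; equality holds if and only if T is isomorphic to T_n, where T_n = K_1 ∗ (2K_1 ∪ ((n−3)/2)K_2) if n is odd and T_n = K_1 ∗ (3K_1 ∪ ((n−4)/2)K_2) if n is even. -/

import Mathlib

open SimpleGraph

/-- `S` is a dissociation set of `G`: every vertex of `S` has at most one neighbor in `S`. -/
def IsDissociation {V : Type*} (G : SimpleGraph V) (S : Set V) : Prop :=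
  ∀ v ∈ S, (G.neighborSet v ∩ S).Subsingleton

/-- `d(G)`: the number of dissociation sets of `G`. -/
noncomputable def dissocNum {V : Type*} (G : SimpleGraph V) : ℕ :=
  Nat.card {S : Set V // IsDissociation G S}

/-- `K_{r+1} ∗ (K_{s₀+1} ∪ ⋯ ∪ K_{sₜ+1})`: the hub `Sum.inl 0` of the complete graph
`K_{r+1}` is joined to the vertex `0` of each complete component. -/
def starGraph (r : ℕ) (s : List ℕ) :
    SimpleGraph (Fin (r + 1) ⊕ (Σ i : Fin s.length, Fin (s.get i + 1))) where
  Adj x y := x ≠ y ∧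
    (Sum.elim (fun _ => (none : Option (Fin s.length))) (fun p => some p.1) x =
        Sum.elim (fun _ => (none : Option (Fin s.length))) (fun p => some p.1) y ∨
      (x = Sum.inl 0 ∧ ∃ i, y = Sum.inr ⟨i, 0⟩) ∨
      (y = Sum.inl 0 ∧ ∃ i, x = Sum.inr ⟨i, 0⟩))
  symm := by
    constructor
    rintro x y ⟨h1, h2⟩
    refine ⟨h1.symm, ?_⟩
    rcases h2 with h | h | h
    · exact Or.inl h.symm
    · exact Or.inr (Or.inr h)
    · exact Or.inr (Or.inl h)
  loopless := ⟨fun x h => h.1 rfl⟩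

/-- `h(n) = 2^{n−1} + (n+9)·2^{(n−7)/2}` for odd `n` and
`h(n) = 2^{n−1} + (n+12)·2^{(n−8)/2}` for even `n`. -/
def hBound (n : ℕ) : ℕ :=
  if Odd n then 2 ^ (n - 1) + (n + 9) * 2 ^ ((n - 7) / 2)
  else 2 ^ (n - 1) + (n + 12) * 2 ^ ((n - 8) / 2)

/-- `G ≅ F_n`, where `F_n = K₁ ∗ ((n−1)/2)K₂` if `n` is odd and
`F_n = K₂ ∗ ((n−2)/2)K₂` if `n` is even. -/
def IsFGraph (n : ℕ) {V : Type*} (G : SimpleGraph V) : Prop :=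
  if Odd n then Nonempty (G ≃g starGraph 0 (List.replicate ((n - 1) / 2) 1))
  else Nonempty (G ≃g starGraph 1 (List.replicate ((n - 2) / 2) 1))

/-- `G ≅ T_n`, where `T_n = K₁ ∗ (2K₁ ∪ ((n−3)/2)K₂)` if `n` is odd and
`T_n = K₁ ∗ (3K₁ ∪ ((n−4)/2)K₂)` if `n` is even. -/
def IsTGraph (n : ℕ) {V : Type*} (G : SimpleGraph V) : Prop :=
  if Odd n then
    Nonempty (G ≃g starGraph 0 (List.replicate 2 0 ++ List.replicate ((n - 3) / 2) 1))
  else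
    Nonempty (G ≃g starGraph 0 (List.replicate 3 0 ++ List.replicate ((n - 4) / 2) 1))

section Counting

open Classical

variable {V : Type*}

theorem IsDissociation.mono {G : SimpleGraph V} {S S' : Set V} (h : IsDissociation G S')
    (hS : S ⊆ S') : IsDissociation G S := fun v hv =>
  (h v (hS hv)).anti (Set.inter_subset_inter_right _ hS)

/-- The number of dissociation sets of `G` contained in `A`. -/
noncomputable def dissocCount (G : SimpleGraph V) (A : Finset V) : ℕ :=
  (A.powerset.filter fun S : Finset V => IsDissociation G (S : Set V)).card

theorem dissocNum_eq_dissocCount_univ [Fintype V] (G : SimpleGraph V) :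
    dissocNum G = dissocCount G Finset.univ := by
  rw [dissocNum, dissocCount, Nat.card_eq_fintype_card, Fintype.card_subtype]
  symm
  refine Finset.card_bij (fun S _ => (S : Set V)) ?_ ?_ ?_
  · intro S hS
    simpa using hS
  · intro S _ S' _ h
    exact_mod_cast h
  · intro S hS
    refine ⟨S.toFinset, ?_, by simp⟩
    simpa using hS

theorem dissocCount_le_two_pow (G : SimpleGraph V) (A : Finset V) :
    dissocCount G A ≤ 2 ^ A.card :=
  (Finset.card_filter_le _ _).trans (Finset.card_powerset A).le

theorem dissocCount_eq_two_pow {G : SimpleGraph V} {A : Finset V}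
    (h : IsDissociation G (A : Set V)) : dissocCount G A = 2 ^ A.card := by
  rw [dissocCount, Finset.filter_true_of_mem, Finset.card_powerset]
  intro S hS
  exact h.mono (by exact_mod_cast Finset.mem_powerset.1 hS)

theorem dissocCount_union_le (G : SimpleGraph V) (A B : Finset V) :
    dissocCount G (A ∪ B) ≤ dissocCount G A * dissocCount G B := by
  rw [dissocCount, dissocCount, dissocCount, ← Finset.card_product]
  refine Finset.card_le_card_of_injOn (fun S => (S ∩ A, S ∩ B)) ?_ ?_
  · intro S hS
    simp only [Finset.coe_filter, Finset.mem_powerset, Set.mem_ofPred_eq] at hS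
    simp only [Finset.coe_product, Finset.coe_filter, Finset.mem_powerset, Set.mem_prod,
      Set.mem_ofPred_eq]
    exact ⟨⟨Finset.inter_subset_right, hS.2.mono (by simp)⟩,
      ⟨Finset.inter_subset_right, hS.2.mono (by simp)⟩⟩
  · intro S hS S' hS' h
    simp only [Finset.coe_filter, Finset.mem_powerset, Set.mem_ofPred_eq] at hS hS'
    simp only [Prod.mk.injEq] at h
    rw [← Finset.inter_eq_left.2 hS.1, ← Finset.inter_eq_left.2 hS'.1,
      Finset.inter_union_distrib_left, Finset.inter_union_distrib_left, h.1, h.2]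

theorem dissocCount_biUnion_le {ι : Type*} (G : SimpleGraph V) (s : Finset ι)
    (B : ι → Finset V) : dissocCount G (s.biUnion B) ≤ ∏ i ∈ s, dissocCount G (B i) := by
  induction s using Finset.induction_on with
  | empty => simpa using dissocCount_le_two_pow G ∅
  | insert a s ha ih =>
    rw [Finset.biUnion_insert, Finset.prod_insert ha]
    exact (dissocCount_union_le G _ _).trans (Nat.mul_le_mul_left _ ih)

theorem dissocCount_le_mul_two_pow (G : SimpleGraph V) {A B : Finset V} (h : A ⊆ B) :
    dissocCount G B ≤ dissocCount G A * 2 ^ (B.card - A.card) := by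
  have := dissocCount_union_le G A (B \ A)
  rw [Finset.union_sdiff_of_subset h] at this
  refine this.trans (Nat.mul_le_mul_left _ ?_)
  rw [← Finset.card_sdiff_of_subset h]
  exact dissocCount_le_two_pow _ _

theorem dissocCount_le_dissocNum_induce (G : SimpleGraph V) (A : Finset V) :
    dissocCount G A ≤ dissocNum (G.induce (A : Set V)) := by
  rw [dissocNum_eq_dissocCount_univ, dissocCount, dissocCount]
  refine Finset.card_le_card_of_injOn
    (fun S => Finset.univ.filter fun x : (A : Set V) => (x : V) ∈ S) ?_ ?_
  · intro S hS
    simp only [Finset.coe_filter, Finset.mem_powerset, Set.mem_ofPred_eq, Finset.subset_univ,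
      true_and] at hS ⊢
    intro x hx y hy z hz
    simp only [Finset.mem_univ, true_and, Set.mem_ofPred_eq, Set.mem_inter_iff,
      SimpleGraph.mem_neighborSet, SimpleGraph.comap_adj,
      Function.Embedding.subtype_apply] at hx hy hz
    exact Subtype.ext (hS.2 x hx hy hz)
  · intro S hS S' hS' h
    simp only [Finset.coe_filter, Finset.mem_powerset, Set.mem_ofPred_eq] at hS hS'
    ext x
    have hx : ∀ hxA : x ∈ A, x ∈ S ↔ x ∈ S' := fun hxA => by
      simpa using congrArg (fun F => (⟨x, hxA⟩ : (A : Set V)) ∈ F) h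
    exact ⟨fun h1 => (hx (hS.1 h1)).1 h1, fun h1 => (hx (hS'.1 h1)).2 h1⟩

theorem isDissociation_insert_iff {G : SimpleGraph V} {v : V} {S : Set V}
    (hS : ∀ x ∈ S, ¬ G.Adj v x) : IsDissociation G (insert v S) ↔ IsDissociation G S := by
  refine ⟨fun h => h.mono (Set.subset_insert _ _), fun h x hx y hy z hz => ?_⟩
  have key : ∀ a b, a ∈ insert v S → b ∈ insert v S → G.Adj a b → a ∈ S ∧ b ∈ S := by
    rintro a b (rfl | ha) (rfl | hb) hab
    · exact (G.irrefl hab).elim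
    · exact (hS _ hb hab).elim
    · exact (hS _ ha hab.symm).elim
    · exact ⟨ha, hb⟩
  have h1 := key x y hx hy.2 hy.1
  have h2 := key x z hx hz.2 hz.1
  exact h x h1.1 ⟨hy.1, h1.2⟩ ⟨hz.1, h2.2⟩

theorem isDissociation_insert_insert_iff {G : SimpleGraph V} {v w : V} {S : Set V}
    (hv : ∀ x ∈ S, ¬ G.Adj v x) (hw : ∀ x ∈ S, ¬ G.Adj w x) :
    IsDissociation G (insert v (insert w S)) ↔ IsDissociation G S := by
  refine ⟨fun h => h.mono ((Set.subset_insert _ _).trans (Set.subset_insert _ _)),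
    fun h x hx y hy z hz => ?_⟩
  have key : ∀ a b, a ∈ insert v (insert w S) → b ∈ insert v (insert w S) → G.Adj a b →
      (a = v ∧ b = w) ∨ (a = w ∧ b = v) ∨ (a ∈ S ∧ b ∈ S) := by
    rintro a b (rfl | rfl | ha) (rfl | rfl | hb) hab
    · exact (G.irrefl hab).elim
    · exact Or.inl ⟨rfl, rfl⟩
    · exact (hv _ hb hab).elim
    · exact Or.inr (Or.inl ⟨rfl, rfl⟩)
    · exact (G.irrefl hab).elim
    · exact (hw _ hb hab).elim
    · exact (hv _ ha hab.symm).elim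
    · exact (hw _ ha hab.symm).elim
    · exact Or.inr (Or.inr ⟨ha, hb⟩)
  have h1 := key x y hx hy.2 hy.1
  have h2 := key x z hx hz.2 hz.1
  by_cases hxS : x ∈ S
  · by_cases hyv : G.Adj x v
    · exact (hv x hxS hyv.symm).elim
    · by_cases hyw : G.Adj x w
      · exact (hw x hxS hyw.symm).elim
      · have h1' : y ∈ S := by
          rcases h1 with ⟨_, rfl⟩ | ⟨_, rfl⟩ | h1
          · exact (hyw hy.1).elim
          · exact (hyv hy.1).elim
          · exact h1.2
        have h2' : z ∈ S := by
          rcases h2 with ⟨_, rfl⟩ | ⟨_, rfl⟩ | h2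
          · exact (hyw hz.1).elim
          · exact (hyv hz.1).elim
          · exact h2.2
        exact h x hxS ⟨hy.1, h1'⟩ ⟨hz.1, h2'⟩
  · rcases h1 with ⟨hx1, rfl⟩ | ⟨hx1, rfl⟩ | h1
    · rcases h2 with ⟨_, rfl⟩ | ⟨hx2, rfl⟩ | h2
      · rfl
      · exact (G.irrefl (hx1 ▸ hz.1)).elim
      · exact (hxS h2.1).elim
    · rcases h2 with ⟨hx2, rfl⟩ | ⟨_, rfl⟩ | h2
      · exact (G.irrefl (hx1 ▸ hz.1)).elim
      · rfl
      · exact (hxS h2.1).elim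
    · exact (hxS h1.1).elim

variable [Fintype V]

theorem card_isolated_eq (G : SimpleGraph V) (v : V) :
    (Finset.univ.filter fun S : Finset V =>
      IsDissociation G (S : Set V) ∧ v ∈ S ∧ ∀ x ∈ S, ¬ G.Adj v x).card =
      dissocCount G (Finset.univ.filter fun x => x ≠ v ∧ ¬ G.Adj v x) := by
  symm
  refine Finset.card_bij (fun S _ => insert v S) ?_ ?_ ?_
  · intro S hS
    simp only [Finset.mem_filter, Finset.mem_powerset, Finset.subset_iff, Finset.mem_univ,
      true_and] at hS
    simp only [Finset.mem_filter, Finset.mem_univ, true_and, Finset.coe_insert,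
      Finset.mem_insert_self, Finset.mem_insert, forall_eq_or_imp, G.irrefl, not_false_eq_true]
    exact ⟨(isDissociation_insert_iff fun x hx => (hS.1 hx).2).2 hS.2, fun x hx => (hS.1 hx).2⟩
  · intro S hS S' hS' h
    simp only [Finset.mem_filter, Finset.mem_powerset, Finset.subset_iff, Finset.mem_univ,
      true_and] at hS hS'
    have h1 : v ∉ S := fun hv => (hS.1 hv).1 rfl
    have h2 : v ∉ S' := fun hv => (hS'.1 hv).1 rfl
    rw [← Finset.erase_insert h1, ← Finset.erase_insert h2, h]
  · intro S hS
    simp only [Finset.mem_filter, Finset.mem_univ, true_and] at hS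
    refine ⟨S.erase v, ?_, Finset.insert_erase hS.2.1⟩
    simp only [Finset.mem_filter, Finset.mem_powerset, Finset.subset_iff, Finset.mem_univ,
      true_and, Finset.mem_erase]
    exact ⟨fun x hx => ⟨hx.1, hS.2.2 x hx.2⟩, hS.1.mono (by simp)⟩

theorem card_matched_eq (G : SimpleGraph V) {v w : V} (hvw : G.Adj v w) :
    (Finset.univ.filter fun S : Finset V =>
      IsDissociation G (S : Set V) ∧ v ∈ S ∧ w ∈ S).card =
      dissocCount G (Finset.univ.filter fun x => ¬ G.Adj v x ∧ ¬ G.Adj w x) := by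
  symm
  refine Finset.card_bij (fun S _ => insert v (insert w S)) ?_ ?_ ?_
  · intro S hS
    simp only [Finset.mem_filter, Finset.mem_powerset, Finset.subset_iff, Finset.mem_univ,
      true_and] at hS
    simp only [Finset.mem_filter, Finset.mem_univ, true_and, Finset.coe_insert,
      Finset.mem_insert_self, Finset.mem_insert, or_true, and_true]
    exact (isDissociation_insert_insert_iff (fun x hx => (hS.1 hx).1)
      fun x hx => (hS.1 hx).2).2 hS.2
  · intro S hS S' hS' h
    simp only [Finset.mem_filter, Finset.mem_powerset, Finset.subset_iff, Finset.mem_univ,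
      true_and] at hS hS'
    have aux : ∀ {S : Finset V}, (∀ ⦃x⦄, x ∈ S → ¬ G.Adj v x ∧ ¬ G.Adj w x) →
        ((insert v (insert w S)).erase v).erase w = S := by
      intro S hS
      have h1 : v ∉ S := fun hv => (hS hv).2 hvw.symm
      have h2 : w ∉ S := fun hv => (hS hv).1 hvw
      rw [Finset.erase_insert (by simp [h1, hvw.ne]), Finset.erase_insert h2]
    rw [← aux hS.1, ← aux hS'.1, h]
  · intro S hS
    simp only [Finset.mem_filter, Finset.mem_univ, true_and] at hS
    refine ⟨(S.erase v).erase w, ?_, ?_⟩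
    · simp only [Finset.mem_filter, Finset.mem_powerset, Finset.subset_iff, Finset.mem_univ,
        true_and, Finset.mem_erase]
      refine ⟨fun x hx => ⟨fun h => hx.1 ?_, fun h => hx.2.1 ?_⟩, hS.1.mono ?_⟩
      · exact hS.1 v hS.2.1 ⟨h, hx.2.2⟩ ⟨hvw, hS.2.2⟩
      · exact hS.1 w hS.2.2 ⟨h, hx.2.2⟩ ⟨hvw.symm, hS.2.1⟩
      · intro x hx
        simp only [Finset.coe_erase, Set.mem_sdiff, Finset.mem_coe] at hx
        exact hx.1.1
    · rw [Finset.insert_erase (by simp [hvw.ne', hS.2.2]), Finset.insert_erase hS.2.1]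

/-- Dissociation sets are counted according to whether they avoid `v`, contain `v` isolated, or
contain `v` matched to one of its neighbors. -/
theorem dissocNum_eq_hub (G : SimpleGraph V) (v : V) :
    dissocNum G = dissocCount G (Finset.univ.erase v) +
      dissocCount G (Finset.univ.filter fun x => x ≠ v ∧ ¬ G.Adj v x) +
      ∑ w ∈ G.neighborFinset v,
        dissocCount G (Finset.univ.filter fun x => ¬ G.Adj v x ∧ ¬ G.Adj w x) := by
  have h3 : ∑ w ∈ G.neighborFinset v,
        dissocCount G (Finset.univ.filter fun x => ¬ G.Adj v x ∧ ¬ G.Adj w x) =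
      ((G.neighborFinset v).biUnion fun w => Finset.univ.filter fun S : Finset V =>
        IsDissociation G (S : Set V) ∧ v ∈ S ∧ w ∈ S).card := by
    rw [Finset.card_biUnion]
    · exact Finset.sum_congr rfl fun w hw =>
        (card_matched_eq G ((G.mem_neighborFinset v w).1 hw)).symm
    · intro a ha b hb hab
      rw [Function.onFun, Finset.disjoint_left]
      intro S h1 h2
      simp only [Finset.mem_coe, mem_neighborFinset] at ha hb
      simp only [Finset.mem_filter, Finset.mem_univ, true_and] at h1 h2
      exact hab (h1.1 v h1.2.1 ⟨ha, h1.2.2⟩ ⟨hb, h2.2.2⟩)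
  rw [h3, ← card_isolated_eq, dissocNum_eq_dissocCount_univ, dissocCount, dissocCount,
    ← Finset.card_union_of_disjoint, ← Finset.card_union_of_disjoint]
  · congr 1
    ext S
    simp only [Finset.mem_filter, Finset.mem_powerset, Finset.subset_univ, true_and,
      Finset.mem_union, Finset.subset_erase, Finset.mem_univ, Finset.mem_biUnion,
      mem_neighborFinset]
    by_cases hv : v ∈ S
    · by_cases hw : ∃ w ∈ S, G.Adj v w
      · obtain ⟨w, hwS, hw⟩ := hw
        exact ⟨fun h => Or.inr ⟨w, hw, h, hv, hwS⟩, by tauto⟩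
      · push Not at hw
        exact ⟨fun h => Or.inl (Or.inr ⟨h, hv, hw⟩), by tauto⟩
    · tauto
  · rw [Finset.disjoint_left]
    intro S h1 h2
    simp only [Finset.mem_filter, Finset.mem_powerset, Finset.subset_univ, true_and,
      Finset.mem_union, Finset.subset_erase, Finset.mem_univ, Finset.mem_biUnion,
      mem_neighborFinset] at h1 h2
    obtain ⟨w, hw, _, hv, hwS⟩ := h2
    rcases h1 with h1 | h1
    · exact h1.1 hv
    · exact h1.2.2 w hwS hw
  · rw [Finset.disjoint_left]
    intro S h1 h2
    simp only [Finset.mem_filter, Finset.mem_powerset, Finset.subset_univ, true_and,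
      Finset.subset_erase, Finset.mem_univ] at h1 h2
    exact h1.1 h2.2.1

end Counting

section Branches

open Classical

variable {V : Type*} {T : SimpleGraph V}

theorem SimpleGraph.Connected.exists_adj_dist_eq (hT : T.Connected) {x v : V} (h : x ≠ v) :
    ∃ w, T.Adj v w ∧ T.dist x v = T.dist x w + 1 := by
  obtain ⟨p, hp⟩ := hT.exists_walk_length_eq_dist v x
  cases p with
  | nil => exact (h rfl).elim
  | @cons _ w _ hvw q =>
    refine ⟨w, hvw, le_antisymm ?_ ?_⟩
    · have := hT.dist_triangle (u := x) (v := w) (w := v)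
      rwa [dist_eq_one_iff_adj.2 hvw.symm] at this
    · rw [dist_comm (u := x) (v := v), ← hp, dist_comm, Walk.length_cons]
      exact Nat.succ_le_succ (dist_le q)

theorem SimpleGraph.IsTree.eq_of_adj_of_dist_eq (hT : T.IsTree) {x v w w' : V} (hw : T.Adj v w)
    (hw' : T.Adj v w') (h : T.dist x v = T.dist x w + 1) (h' : T.dist x v = T.dist x w' + 1) :
    w = w' := by
  obtain ⟨p, hp⟩ := hT.connected.exists_walk_length_eq_dist w x
  obtain ⟨p', hp'⟩ := hT.connected.exists_walk_length_eq_dist w' x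
  have h1 : (Walk.cons hw p).IsPath := Walk.isPath_of_length_eq_dist _ (by
    rw [Walk.length_cons, hp, dist_comm, ← h, dist_comm])
  have h2 : (Walk.cons hw' p').IsPath := Walk.isPath_of_length_eq_dist _ (by
    rw [Walk.length_cons, hp', dist_comm, ← h', dist_comm])
  have h3 := (hT.isAcyclic.subsingleton_path _ _).elim ⟨_, h1⟩ ⟨_, h2⟩
  simp only [Subtype.mk.injEq, Walk.cons.injEq] at h3
  exact h3.1

theorem SimpleGraph.IsTree.not_adj_of_adj_of_adj (hT : T.IsTree) {v w x : V} (hvw : T.Adj v w)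
    (hv : T.Adj v x) : ¬ T.Adj w x := fun hw =>
  hT.dist_ne_of_adj x hvw (by
    rw [dist_eq_one_iff_adj.2 hv.symm, dist_eq_one_iff_adj.2 hw.symm])

variable [Fintype V]

/-- For adjacent `v` and `w` in a tree, the component containing `w` after deleting `v`. -/
noncomputable def branch (T : SimpleGraph V) (v w : V) : Finset V :=
  Finset.univ.filter fun x => T.dist x w < T.dist x v

theorem mem_branch {v w x : V} : x ∈ branch T v w ↔ T.dist x w < T.dist x v := by
  simp [branch]

theorem mem_branch_iff (hT : T.IsTree) {v w : V} (hvw : T.Adj v w) {x : V} :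
    x ∈ branch T v w ↔ T.dist x v = T.dist x w + 1 := by
  rw [mem_branch]
  have := hT.dist_eq_dist_add_one_of_adj x hvw
  omega

theorem mem_branch_self {v w : V} (hvw : T.Adj v w) : w ∈ branch T v w := by
  rw [mem_branch, dist_self, dist_eq_one_iff_adj.2 hvw.symm]
  exact one_pos

theorem notMem_branch_left (v w : V) : v ∉ branch T v w := by
  simp [mem_branch]

theorem branch_swap (hT : T.IsTree) {v w : V} (hvw : T.Adj v w) :
    branch T w v = (branch T v w)ᶜ := by
  ext x
  rw [Finset.mem_compl, mem_branch, mem_branch]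
  have := hT.dist_eq_dist_add_one_of_adj x hvw
  omega

theorem card_branch_add_card_branch (hT : T.IsTree) {v w : V} (hvw : T.Adj v w) :
    (branch T v w).card + (branch T w v).card = Fintype.card V := by
  rw [branch_swap hT hvw, Finset.card_add_card_compl]

theorem biUnion_branch (hT : T.IsTree) (v : V) :
    (T.neighborFinset v).biUnion (branch T v) = Finset.univ.erase v := by
  ext x
  simp only [Finset.mem_biUnion, mem_neighborFinset, Finset.mem_erase, Finset.mem_univ, and_true]
  constructor
  · rintro ⟨w, _, hx⟩ rfl
    exact notMem_branch_left _ _ hx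
  · intro hx
    obtain ⟨w, hw, h⟩ := hT.connected.exists_adj_dist_eq hx
    exact ⟨w, hw, (mem_branch_iff hT hw).2 h⟩

theorem eq_of_mem_branch (hT : T.IsTree) {v w w' x : V} (hw : T.Adj v w) (hw' : T.Adj v w')
    (h : x ∈ branch T v w) (h' : x ∈ branch T v w') : w = w' :=
  hT.eq_of_adj_of_dist_eq hw hw' ((mem_branch_iff hT hw).1 h) ((mem_branch_iff hT hw').1 h')

theorem sum_card_branch (hT : T.IsTree) (v : V) :
    ∑ w ∈ T.neighborFinset v, (branch T v w).card = Fintype.card V - 1 := by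
  rw [← Finset.card_biUnion, biUnion_branch hT, Finset.card_erase_of_mem (Finset.mem_univ _),
    Finset.card_univ]
  intro a ha b hb hab
  rw [Function.onFun, Finset.disjoint_left]
  intro x h1 h2
  simp only [Finset.mem_coe, mem_neighborFinset] at ha hb
  exact hab (eq_of_mem_branch hT ha hb h1 h2)

theorem mem_branch_of_adj (hT : T.IsTree) {v w x y : V} (hvw : T.Adj v w) (hxy : T.Adj x y)
    (hy : y ≠ v) (hx : x ∈ branch T v w) : y ∈ branch T v w := by
  rcases hT.dist_eq_dist_add_one_of_adj v hxy with h | h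
  · obtain ⟨u, hu, h'⟩ := hT.connected.exists_adj_dist_eq hy
    have hyu : y ∈ branch T v u := (mem_branch_iff hT hu).2 h'
    have hxu : x ∈ branch T v u := by
      rw [mem_branch]
      have := hT.connected.dist_triangle (u := x) (v := y) (w := u)
      rw [dist_eq_one_iff_adj.2 hxy] at this
      rw [dist_comm, dist_comm (v := y)] at h
      omega
    rwa [eq_of_mem_branch hT hvw hu hx hxu]
  · rw [mem_branch_iff hT hvw] at hx
    rw [mem_branch]
    have := hT.connected.dist_triangle (u := y) (v := x) (w := w)
    rw [dist_eq_one_iff_adj.2 hxy.symm] at this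
    rw [dist_comm, dist_comm (v := x)] at h
    omega

theorem branch_subset (hT : T.IsTree) {v w u : V} (hvw : T.Adj v w) (hwu : T.Adj w u)
    (huv : u ≠ v) : branch T w u ⊆ branch T v w := by
  intro x hx
  by_contra h
  rw [← Finset.mem_compl, ← branch_swap hT hvw] at h
  exact huv (eq_of_mem_branch hT hwu hvw.symm hx h)

theorem isTree_induce_branch (hT : T.IsTree) {v w : V} (hvw : T.Adj v w) :
    (T.induce (branch T v w : Set V)).IsTree := by
  refine ⟨?_, hT.isAcyclic.induce _⟩
  have hw : w ∈ (branch T v w : Set V) := mem_branch_self hvw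
  have key : ∀ k, ∀ x, ∀ hx : x ∈ (branch T v w : Set V), T.dist x w = k →
      (T.induce (branch T v w : Set V)).Reachable ⟨x, hx⟩ ⟨w, hw⟩ := by
    intro k
    induction k with
    | zero =>
      intro x hx h
      obtain rfl := hT.connected.dist_eq_zero_iff.1 h
      exact Reachable.refl _
    | succ k ih =>
      intro x hx h
      have hne : w ≠ x := by
        rintro rfl
        simp at h
      obtain ⟨y, hy, h'⟩ := hT.connected.exists_adj_dist_eq hne
      have hyv : y ≠ v := by
        rintro rfl
        rw [Finset.mem_coe, mem_branch, dist_eq_one_iff_adj.2 hy] at hx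
        omega
      have hyB := mem_branch_of_adj hT hvw hy hyv (Finset.mem_coe.1 hx)
      have h1 : (T.induce (branch T v w : Set V)).Adj ⟨x, hx⟩ ⟨y, hyB⟩ := hy
      refine h1.reachable.trans (ih y hyB ?_)
      rw [dist_comm] at h
      rw [dist_comm]
      omega
  have : Nonempty (branch T v w : Set V) := ⟨⟨w, hw⟩⟩
  exact Connected.mk fun x y => (key _ x.1 x.2 rfl).trans (key _ y.1 y.2 rfl).symm

/-- A tree has a centroid: a vertex all of whose branches contain at most half of the vertices. -/
theorem exists_centroid (hT : T.IsTree) :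
    ∃ v, ∀ w, T.Adj v w → 2 * (branch T v w).card ≤ Fintype.card V := by
  by_contra! hcon
  have key : ∀ k, ∀ v w, T.Adj v w → (branch T v w).card = k →
      Fintype.card V < 2 * (branch T v w).card → False := by
    intro k
    induction k using Nat.strong_induction_on with
    | _ k ih =>
      intro v w hvw hk hlt
      obtain ⟨u, hu, h⟩ := hcon w
      have huv : u ≠ v := by
        rintro rfl
        have := card_branch_add_card_branch hT hvw
        omega
      have hss : branch T w u ⊂ branch T v w := by
        refine ⟨branch_subset hT hvw hu huv, fun hsub => ?_⟩
        exact notMem_branch_left _ _ (hsub (mem_branch_self hvw))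
      exact ih _ (hk ▸ Finset.card_lt_card hss) w u hu rfl h
  obtain ⟨v⟩ := hT.connected.nonempty
  obtain ⟨w, hw, h⟩ := hcon v
  exact key _ v w hw rfl h

theorem two_le_degree_of_two_le_card_branch (hT : T.IsTree) {v w : V} (hvw : T.Adj v w)
    (h : 2 ≤ (branch T v w).card) : 2 ≤ T.degree w := by
  obtain ⟨x, hx, hxw⟩ := Finset.exists_mem_ne h w
  obtain ⟨u, hu, h'⟩ := hT.connected.exists_adj_dist_eq hxw
  have huv : u ≠ v := by
    rintro rfl
    rw [mem_branch] at hx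
    omega
  rw [← card_neighborFinset_eq_degree]
  exact Finset.one_lt_card.2 ⟨u, (T.mem_neighborFinset _ _).2 hu, v,
    (T.mem_neighborFinset _ _).2 hvw.symm, huv⟩

theorem card_not_adj (G : SimpleGraph V) (v : V) :
    (Finset.univ.filter fun x => x ≠ v ∧ ¬ G.Adj v x).card =
      Fintype.card V - 1 - G.degree v := by
  have : (Finset.univ.filter fun x => x ≠ v ∧ ¬ G.Adj v x) =
      (insert v (G.neighborFinset v))ᶜ := by
    ext x
    simp
  rw [this, Finset.card_compl, Finset.card_insert_of_notMem (by simp),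
    card_neighborFinset_eq_degree]
  omega

theorem card_not_adj_not_adj (hT : T.IsTree) {v w : V} (hvw : T.Adj v w) :
    (Finset.univ.filter fun x => ¬ T.Adj v x ∧ ¬ T.Adj w x).card =
      Fintype.card V - T.degree v - T.degree w := by
  have : (Finset.univ.filter fun x => ¬ T.Adj v x ∧ ¬ T.Adj w x) =
      (T.neighborFinset v ∪ T.neighborFinset w)ᶜ := by
    ext x
    simp
  rw [this, Finset.card_compl, Finset.card_union_of_disjoint, card_neighborFinset_eq_degree,
    card_neighborFinset_eq_degree]
  · omega
  · rw [Finset.disjoint_left]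
    intro x h1 h2
    exact hT.not_adj_of_adj_of_adj hvw ((T.mem_neighborFinset _ _).1 h1)
      ((T.mem_neighborFinset _ _).1 h2)

theorem degree_add_degree_le (hT : T.IsTree) {v w : V} (hvw : T.Adj v w) :
    T.degree v + T.degree w ≤ Fintype.card V := by
  rw [← card_neighborFinset_eq_degree, ← card_neighborFinset_eq_degree,
    ← Finset.card_union_of_disjoint]
  · exact Finset.card_le_univ _
  · rw [Finset.disjoint_left]
    intro x h1 h2
    exact hT.not_adj_of_adj_of_adj hvw ((T.mem_neighborFinset _ _).1 h1)
      ((T.mem_neighborFinset _ _).1 h2)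

end Branches

section Weights

/-- Sixteen times an upper bound for `d(T) / 2 ^ s` over all trees `T` of order `s`. -/
def treeWeight (s : ℕ) : ℕ :=
  if s ≤ 2 then 16 else if s = 3 then 14 else if s = 4 then 13 else if s = 5 then 12 else 11

/-- Twice an upper bound for the factor `2 ^ (1 - deg w)`, where the branch at `w` has `s`
vertices. -/
def rootWeight (s : ℕ) : ℕ := if s = 1 then 2 else 1

/-- Numerator of the bound for `d(T) / 2 ^ (n - 1)` in terms of the list of branch sizes at a
vertex, over the denominator `16 ^ l.length * 2 ^ (l.length + 1)`. -/
def hubWeight (l : List ℕ) : ℕ :=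
  2 ^ (l.length + 1) * (l.map treeWeight).prod + 16 ^ l.length * (2 + (l.map rootWeight).sum)

theorem treeWeight_min (s : ℕ) : treeWeight (min s 7) = treeWeight s := by
  unfold treeWeight
  split_ifs <;> first | rfl | omega

theorem rootWeight_min (s : ℕ) : rootWeight (min s 7) = rootWeight s := by
  unfold rootWeight
  split_ifs <;> first | rfl | omega

theorem treeWeight_le (s : ℕ) : treeWeight s ≤ 16 := by
  unfold treeWeight
  split_ifs <;> norm_num

theorem treeWeight_le_of_three_le {s : ℕ} (h : 3 ≤ s) : treeWeight s ≤ 14 := by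
  unfold treeWeight
  split_ifs <;> omega

theorem rootWeight_le (s : ℕ) : rootWeight s ≤ 2 := by
  unfold rootWeight
  split_ifs <;> norm_num

theorem prod_treeWeight_le (l : List ℕ) : (l.map treeWeight).prod ≤ 16 ^ l.length := by
  induction l with
  | nil => simp
  | cons a l ih =>
    rw [List.map_cons, List.prod_cons, List.length_cons, pow_succ']
    exact Nat.mul_le_mul (treeWeight_le a) ih

theorem prod_treeWeight_le_of_three_le {l : List ℕ} (h : ∃ s ∈ l, 3 ≤ s) :
    16 * (l.map treeWeight).prod ≤ 14 * 16 ^ l.length := by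
  induction l with
  | nil => simp at h
  | cons a l ih =>
    rw [List.map_cons, List.prod_cons, List.length_cons, pow_succ']
    by_cases ha : 3 ≤ a
    · have := Nat.mul_le_mul (treeWeight_le_of_three_le ha) (prod_treeWeight_le l)
      omega
    · obtain ⟨s, hs, h3⟩ := h
      have hl : s ∈ l := by
        rcases List.mem_cons.1 hs with rfl | hs
        · exact (ha h3).elim
        · exact hs
      have h1 := ih ⟨s, hl, h3⟩
      have h2 := Nat.mul_le_mul (treeWeight_le a) h1
      calc 16 * (treeWeight a * (l.map treeWeight).prod)
          = treeWeight a * (16 * (l.map treeWeight).prod) := by ring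
        _ ≤ 16 * (14 * 16 ^ l.length) := h2
        _ = 14 * (16 * 16 ^ l.length) := by ring

theorem sum_rootWeight_le (l : List ℕ) : (l.map rootWeight).sum ≤ 2 * l.length := by
  induction l with
  | nil => simp
  | cons a l ih =>
    rw [List.map_cons, List.sum_cons, List.length_cons]
    have := rootWeight_le a
    omega

theorem hubWeight_le_of_six_le_length {l : List ℕ} (h : ∃ s ∈ l, 3 ≤ s) (h6 : 6 ≤ l.length) :
    hubWeight l ≤ 16 ^ l.length * 2 ^ (l.length + 1) := by
  have h1 := prod_treeWeight_le_of_three_le h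
  have h2 := sum_rootWeight_le l
  have h3 : ∀ k, 6 ≤ k → 16 * (2 + 2 * k) ≤ 2 * 2 ^ (k + 1) := by
    intro k hk
    induction k, hk using Nat.le_induction with
    | base => norm_num
    | succ k hk ih =>
      rw [pow_succ]
      omega
  have h4 := Nat.mul_le_mul_left (16 ^ l.length) (h3 _ h6)
  have h5 := Nat.mul_le_mul_left (2 ^ (l.length + 1)) h1
  have h6 : 16 ^ l.length * (2 + (l.map rootWeight).sum) ≤
      16 ^ l.length * (2 + 2 * l.length) := Nat.mul_le_mul_left _ (by omega)
  unfold hubWeight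
  nlinarith

theorem two_pow_lt_hBound {n : ℕ} : 2 ^ (n - 1) < hBound n := by
  unfold hBound
  split_ifs
  · exact Nat.lt_add_of_pos_right (by positivity)
  · exact Nat.lt_add_of_pos_right (by positivity)

theorem two_pow_mul_lt_hBound_mul {n w d : ℕ} (hd : 0 < d) (h : w ≤ d) :
    2 ^ (n - 1) * w < hBound n * d :=
  (Nat.mul_le_mul_left _ h).trans_lt (Nat.mul_lt_mul_of_pos_right two_pow_lt_hBound hd)

/-- `allSorted m k a p` tests `p` on all weakly increasing lists of length `k` with entries in
`a, …, m`. -/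
def allSorted (m : ℕ) : ℕ → ℕ → (List ℕ → Bool) → Bool
  | 0, _, p => p []
  | k + 1, a, p => (List.range' a (m + 1 - a)).all fun s => allSorted m k s fun l => p (s :: l)

theorem of_allSorted {m a : ℕ} {l : List ℕ} {p : List ℕ → Bool} (hl : l.Pairwise (· ≤ ·))
    (hp : allSorted m l.length a p = true) (ha : ∀ s ∈ l, a ≤ s) (hm : ∀ s ∈ l, s ≤ m) :
    p l = true := by
  induction l generalizing p a with
  | nil => exact hp
  | cons s l ih =>
    have h1 := ha s (by simp)
    have h2 := hm s (by simp)
    rw [List.length_cons, allSorted, List.all_eq_true] at hp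
    rw [List.pairwise_cons] at hl
    exact ih hl.2 (hp s (List.mem_range'_1.2 (by omega))) hl.1 fun t ht => hm t (by simp [ht])

theorem of_allSorted_of_perm {m : ℕ} {l : List ℕ} {p : List ℕ → Bool}
    (hperm : ∀ l₁ l₂ : List ℕ, l₁.Perm l₂ → p l₁ = p l₂)
    (hp : allSorted m l.length 1 p = true) (h1 : ∀ s ∈ l, 1 ≤ s) (hm : ∀ s ∈ l, s ≤ m) :
    p l = true := by
  have h := List.perm_insertionSort (· ≤ ·) l
  rw [← hperm _ _ h]
  exact of_allSorted (List.pairwise_insertionSort _ l) (by rwa [h.length_eq])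
    (fun s hs => h1 s (h.mem_iff.1 hs)) fun s hs => hm s (h.mem_iff.1 hs)

theorem hubWeight_perm {l₁ l₂ : List ℕ} (h : l₁.Perm l₂) : hubWeight l₁ = hubWeight l₂ := by
  rw [hubWeight, hubWeight, h.length_eq, (h.map _).prod_eq, (h.map _).sum_eq]

theorem min_sum_le_sum_min (l : List ℕ) (k : ℕ) :
    min l.sum k ≤ (l.map fun s => min s k).sum := by
  induction l with
  | nil => simp
  | cons a l ih =>
    rw [List.map_cons, List.sum_cons, List.sum_cons]
    omega

theorem hubWeight_map_min (l : List ℕ) : hubWeight (l.map fun s => min s 7) = hubWeight l := by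
  simp only [hubWeight, List.length_map, List.map_map]
  congr 4
  · exact funext treeWeight_min
  · exact List.map_congr_left fun s _ => rootWeight_min s

theorem balanced_map_min {l : List ℕ} (h : ∀ s ∈ l, 2 * s ≤ l.sum + 1) (k : ℕ) :
    ∀ s ∈ l.map fun s => min s k, 2 * s ≤ (l.map fun s => min s k).sum + 1 := by
  intro t ht
  obtain ⟨s, hs, rfl⟩ := List.mem_map.1 ht
  have hp := List.perm_cons_erase hs
  have h1 := h s hs
  rw [hp.sum_eq, List.sum_cons] at h1
  rw [(hp.map fun s => min s k).sum_eq, List.map_cons, List.sum_cons]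
  have := min_sum_le_sum_min (l.erase s) k
  omega

theorem hubWeight_small_check : ∀ k < 6, allSorted 3 k 1 (fun l => decide
    (2 ≤ l.sum → l.sum ≤ 5 → (∀ s ∈ l, 2 * s ≤ l.sum + 1) →
    16 * (2 ^ l.sum * hubWeight l) ≤
      treeWeight (l.sum + 1) * 2 ^ (l.sum + 1) * (16 ^ l.length * 2 ^ (l.length + 1)))) = true := by
  decide +kernel

theorem hubWeight_check_of_mem : ∀ k < 6, allSorted 7 k 1 (fun l => decide
    (7 ∈ l → (∀ s ∈ l, 2 * s ≤ l.sum + 1) →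
    hubWeight l ≤ 16 ^ l.length * 2 ^ (l.length + 1))) = true := by
  decide +kernel

theorem hubWeight_check : ∀ k < 6, allSorted 6 k 1 (fun l => decide
    (8 ≤ l.sum → (l.length = 2 → 10 ≤ l.sum) → (∃ s ∈ l, 3 ≤ s) →
    (∀ s ∈ l, 2 * s ≤ l.sum + 1) →
    2 ^ l.sum * hubWeight l <
      hBound (l.sum + 1) * (16 ^ l.length * 2 ^ (l.length + 1)))) = true := by
  decide +kernel

theorem length_le_sum {l : List ℕ} (h : ∀ s ∈ l, 1 ≤ s) : l.length ≤ l.sum := by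
  simpa using List.card_nsmul_le_sum l 1 h

theorem hubWeight_small {l : List ℕ} (h1 : ∀ s ∈ l, 1 ≤ s) (h2 : 2 ≤ l.sum) (h5 : l.sum ≤ 5)
    (hb : ∀ s ∈ l, 2 * s ≤ l.sum + 1) : 16 * (2 ^ l.sum * hubWeight l) ≤
      treeWeight (l.sum + 1) * 2 ^ (l.sum + 1) * (16 ^ l.length * 2 ^ (l.length + 1)) := by
  have := length_le_sum h1
  exact of_decide_eq_true (of_allSorted_of_perm
    (fun l₁ l₂ h => by simp only [h.sum_eq, h.length_eq, h.mem_iff, hubWeight_perm h])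
    (hubWeight_small_check l.length (by omega)) h1 fun s hs => by have := hb s hs; omega) h2 h5 hb

theorem hubWeight_lt {l : List ℕ} (h1 : ∀ s ∈ l, 1 ≤ s) (h8 : 8 ≤ l.sum)
    (h10 : l.length = 2 → 10 ≤ l.sum) (h3 : ∃ s ∈ l, 3 ≤ s)
    (hb : ∀ s ∈ l, 2 * s ≤ l.sum + 1) :
    2 ^ l.sum * hubWeight l < hBound (l.sum + 1) * (16 ^ l.length * 2 ^ (l.length + 1)) := by
  by_cases h6 : 6 ≤ l.length
  · exact two_pow_mul_lt_hBound_mul (n := l.sum + 1) (by positivity)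
      (hubWeight_le_of_six_le_length h3 h6)
  by_cases hlarge : ∃ s ∈ l, 7 ≤ s
  · refine two_pow_mul_lt_hBound_mul (n := l.sum + 1) (by positivity) ?_
    obtain ⟨s, hs, h⟩ := hlarge
    have hcheck := hubWeight_check_of_mem (l.map fun s => min s 7).length
      (by rw [List.length_map]; omega)
    have := of_decide_eq_true (of_allSorted_of_perm
      (fun l₁ l₂ h => by simp only [h.sum_eq, h.length_eq, h.mem_iff, hubWeight_perm h]) hcheck
      (by
        intro t ht
        obtain ⟨s, hs, rfl⟩ := List.mem_map.1 ht
        have := h1 s hs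
        omega)
      (by
        intro t ht
        obtain ⟨s, hs, rfl⟩ := List.mem_map.1 ht
        omega)) (List.mem_map.2 ⟨s, hs, by omega⟩) (balanced_map_min hb 7)
    rwa [hubWeight_map_min, List.length_map] at this
  · push Not at hlarge
    exact of_decide_eq_true (of_allSorted_of_perm
      (fun l₁ l₂ h => by simp only [h.sum_eq, h.length_eq, h.mem_iff, hubWeight_perm h])
      (hubWeight_check l.length (by omega)) h1
      fun s hs => by have := hlarge s hs; omega) h8 h10 h3 hb

end Weights

section TreeBound

open Classical

variable {V : Type*} [Fintype V] {T : SimpleGraph V}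

/-- The sizes of the branches of a tree at a vertex. -/
noncomputable def branchSizes (T : SimpleGraph V) (v : V) : List ℕ :=
  (T.neighborFinset v).toList.map fun w => (branch T v w).card

theorem length_branchSizes (T : SimpleGraph V) (v : V) :
    (branchSizes T v).length = T.degree v := by
  rw [branchSizes, List.length_map, Finset.length_toList, card_neighborFinset_eq_degree]

theorem sum_branchSizes (hT : T.IsTree) (v : V) :
    (branchSizes T v).sum = Fintype.card V - 1 := by
  rw [branchSizes, Finset.sum_map_toList, sum_card_branch hT]

theorem mem_branchSizes {v : V} {s : ℕ} :
    s ∈ branchSizes T v ↔ ∃ w, T.Adj v w ∧ (branch T v w).card = s := by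
  simp [branchSizes]

theorem one_le_of_mem_branchSizes {v : V} : ∀ s ∈ branchSizes T v, 1 ≤ s := by
  intro s hs
  obtain ⟨w, hw, rfl⟩ := mem_branchSizes.1 hs
  exact Finset.card_pos.2 ⟨w, mem_branch_self hw⟩

theorem dissocCount_erase_mul_le (hT : T.IsTree) {v : V}
    (h : ∀ w, T.Adj v w → 16 * dissocCount T (branch T v w) ≤
      treeWeight (branch T v w).card * 2 ^ (branch T v w).card) :
    dissocCount T (Finset.univ.erase v) * 16 ^ T.degree v ≤
      2 ^ (Fintype.card V - 1) * ((branchSizes T v).map treeWeight).prod := by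
  have h1 := dissocCount_biUnion_le T (T.neighborFinset v) (branch T v)
  rw [biUnion_branch hT] at h1
  calc _ ≤ (∏ w ∈ T.neighborFinset v, dissocCount T (branch T v w)) * 16 ^ T.degree v :=
        Nat.mul_le_mul_right _ h1
    _ = ∏ w ∈ T.neighborFinset v, 16 * dissocCount T (branch T v w) := by
        rw [Finset.prod_mul_distrib, Finset.prod_const, card_neighborFinset_eq_degree, mul_comm]
    _ ≤ ∏ w ∈ T.neighborFinset v,
          treeWeight (branch T v w).card * 2 ^ (branch T v w).card :=
        Finset.prod_le_prod' fun w hw => h w ((mem_neighborFinset _ _ _).1 hw)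
    _ = _ := by
        rw [Finset.prod_mul_distrib, Finset.prod_pow_eq_pow_sum, sum_card_branch hT, mul_comm,
          branchSizes, List.map_map, ← Finset.prod_map_toList]
        rfl

theorem dissocCount_not_adj_mul_le (T : SimpleGraph V) (v : V) :
    dissocCount T (Finset.univ.filter fun x => x ≠ v ∧ ¬ T.Adj v x) * 2 ^ T.degree v ≤
      2 ^ (Fintype.card V - 1) := by
  refine (Nat.mul_le_mul_right _ (dissocCount_le_two_pow T _)).trans ?_
  have := T.degree_lt_card_verts v
  rw [card_not_adj, ← pow_add]
  exact Nat.pow_le_pow_right two_pos (by omega)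

theorem dissocCount_not_adj_not_adj_mul_le (hT : T.IsTree) {v w : V} (hvw : T.Adj v w) :
    dissocCount T (Finset.univ.filter fun x => ¬ T.Adj v x ∧ ¬ T.Adj w x) *
      2 ^ (T.degree v + 1) ≤ 2 ^ (Fintype.card V - 1) * rootWeight (branch T v w).card := by
  refine (Nat.mul_le_mul_right _ (dissocCount_le_two_pow T _)).trans ?_
  have h1 := degree_add_degree_le hT hvw
  have h2 : 0 < T.degree w := (T.degree_pos_iff_exists_adj w).2 ⟨v, hvw.symm⟩
  have h3 := two_le_degree_of_two_le_card_branch hT hvw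
  have h4 : 0 < (branch T v w).card := Finset.card_pos.2 ⟨w, mem_branch_self hvw⟩
  rw [card_not_adj_not_adj hT hvw, ← pow_add]
  unfold rootWeight
  split_ifs with h
  · rw [← pow_succ]
    exact Nat.pow_le_pow_right two_pos (by omega)
  · have := h3 (by omega)
    rw [mul_one]
    exact Nat.pow_le_pow_right two_pos (by omega)

theorem dissocNum_mul_le (hT : T.IsTree) {v : V}
    (h : ∀ w, T.Adj v w → 16 * dissocCount T (branch T v w) ≤
      treeWeight (branch T v w).card * 2 ^ (branch T v w).card) :
    dissocNum T * (16 ^ T.degree v * 2 ^ (T.degree v + 1)) ≤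
      2 ^ (Fintype.card V - 1) * hubWeight (branchSizes T v) := by
  have hA := dissocCount_erase_mul_le hT h
  have hB := dissocCount_not_adj_mul_le T v
  have hC : (∑ w ∈ T.neighborFinset v,
      dissocCount T (Finset.univ.filter fun x => ¬ T.Adj v x ∧ ¬ T.Adj w x)) *
        2 ^ (T.degree v + 1) ≤
      2 ^ (Fintype.card V - 1) * ((branchSizes T v).map rootWeight).sum := by
    have : ((branchSizes T v).map rootWeight).sum =
        ∑ w ∈ T.neighborFinset v, rootWeight (branch T v w).card := by
      rw [branchSizes, List.map_map, ← Finset.sum_map_toList]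
      rfl
    rw [this, Finset.sum_mul, Finset.mul_sum]
    exact Finset.sum_le_sum fun w hw =>
      dissocCount_not_adj_not_adj_mul_le hT ((mem_neighborFinset _ _ _).1 hw)
  rw [dissocNum_eq_hub T v, hubWeight, length_branchSizes]
  have hA' := Nat.mul_le_mul_right (2 ^ (T.degree v + 1)) hA
  have hB' := Nat.mul_le_mul_right (2 * 16 ^ T.degree v) hB
  have hC' := Nat.mul_le_mul_right (16 ^ T.degree v) hC
  rw [pow_succ] at *
  linarith

theorem balanced_branchSizes (hT : T.IsTree) {v : V}
    (hv : ∀ w, T.Adj v w → 2 * (branch T v w).card ≤ Fintype.card V) :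
    ∀ s ∈ branchSizes T v, 2 * s ≤ (branchSizes T v).sum + 1 := by
  intro s hs
  obtain ⟨w, hw, rfl⟩ := mem_branchSizes.1 hs
  have := hv w hw
  have := Fintype.card_pos_iff.2 ⟨v⟩
  rw [sum_branchSizes hT]
  omega

theorem dissocNum_le_two_mul_induce_compl (G : SimpleGraph V) (v : V) :
    dissocNum G ≤ 2 * dissocNum (G.induce ({v}ᶜ : Set V)) := by
  have h1 := dissocCount_le_mul_two_pow G (Finset.subset_univ ({v}ᶜ : Finset V))
  have h2 := dissocCount_le_dissocNum_induce G ({v}ᶜ : Finset V)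
  rw [← dissocNum_eq_dissocCount_univ, Finset.card_compl, Finset.card_singleton,
    Finset.card_univ] at h1
  have := Fintype.card_pos_iff.2 ⟨v⟩
  rw [show Fintype.card V - (Fintype.card V - 1) = 1 by omega, pow_one, mul_comm] at h1
  rw [Finset.coe_compl, Finset.coe_singleton] at h2
  exact h1.trans (Nat.mul_le_mul_left 2 h2)

end TreeBound

section TreeBoundInduction

open Classical

universe u

theorem dissocNum_le_treeWeight (n : ℕ) : ∀ {V : Type u} [Fintype V] {T : SimpleGraph V},
    T.IsTree → Fintype.card V = n → 16 * dissocNum T ≤ treeWeight n * 2 ^ n := by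
  induction n using Nat.strong_induction_on with
  | _ n ih =>
    intro V _ T hT hn
    by_cases h2 : n ≤ 2
    · have : treeWeight n = 16 := by simp [treeWeight, h2]
      rw [this, dissocNum_eq_dissocCount_univ, ← hn, ← Finset.card_univ]
      exact Nat.mul_le_mul_left 16 (dissocCount_le_two_pow T _)
    by_cases h6 : n ≤ 6
    · obtain ⟨v, hv⟩ := exists_centroid hT
      have hbr : ∀ w, T.Adj v w → 16 * dissocCount T (branch T v w) ≤
          treeWeight (branch T v w).card * 2 ^ (branch T v w).card := by
        intro w hw
        have h1 := hv w hw
        refine (Nat.mul_le_mul_left 16 (dissocCount_le_dissocNum_induce T _)).trans ?_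
        exact ih _ (by omega) (isTree_induce_branch hT hw) (by simp)
      have h1 := dissocNum_mul_le hT hbr
      have hs := sum_branchSizes hT v
      have h3 := hubWeight_small one_le_of_mem_branchSizes (by omega) (by omega)
        (balanced_branchSizes hT hv)
      rw [length_branchSizes, hs, hn, Nat.sub_add_cancel (by omega)] at h3
      rw [hn] at h1
      refine Nat.le_of_mul_le_mul_right (c := 16 ^ T.degree v * 2 ^ (T.degree v + 1)) ?_
        (by positivity)
      calc _ = 16 * (dissocNum T * (16 ^ T.degree v * 2 ^ (T.degree v + 1))) := by ring
        _ ≤ _ := (Nat.mul_le_mul_left 16 h1).trans h3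
    · have : Nontrivial V := Fintype.one_lt_card_iff_nontrivial.1 (by omega)
      obtain ⟨v, hv⟩ := hT.connected.exists_connected_induce_compl_singleton_of_finite_nontrivial
      have h1 := dissocNum_le_two_mul_induce_compl T v
      have h3 := ih (n - 1) (by omega) (V := ({v}ᶜ : Set V)) ⟨hv, hT.isAcyclic.induce _⟩
        (by rw [Fintype.card_compl_set, hn]; simp)
      have h4 : treeWeight n = 11 := by
        unfold treeWeight
        split_ifs <;> omega
      have h5 : treeWeight (n - 1) = 11 := by
        unfold treeWeight
        split_ifs <;> omega
      obtain ⟨m, rfl⟩ : ∃ m, n = m + 1 := ⟨n - 1, by omega⟩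
      rw [h5, Nat.add_sub_cancel] at h3
      rw [h4, pow_succ]
      omega

end TreeBoundInduction

section TreeBound

open Classical

variable {V : Type*} [Fintype V] {T : SimpleGraph V}

theorem dissocCount_branch_le (hT : T.IsTree) {v w : V} (hvw : T.Adj v w) :
    16 * dissocCount T (branch T v w) ≤
      treeWeight (branch T v w).card * 2 ^ (branch T v w).card := by
  refine (Nat.mul_le_mul_left 16 (dissocCount_le_dissocNum_induce T _)).trans ?_
  exact dissocNum_le_treeWeight _ (isTree_induce_branch hT hvw) (by simp)

end TreeBound

section LargeBranch

open Classical

variable {V : Type*} [Fintype V] {T : SimpleGraph V}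

theorem dissocCount_not_adj_le_of_degree_eq_two (hT : T.IsTree) {v w : V} (hvw : T.Adj v w)
    (hw : T.degree w = 2) (h4 : 4 ≤ (branch T v w).card) :
    16 * dissocCount T (Finset.univ.filter fun x => x ≠ v ∧ ¬ T.Adj v x) ≤
      14 * 2 ^ (Fintype.card V - 1 - T.degree v) := by
  rw [← card_neighborFinset_eq_degree] at hw
  obtain ⟨x, hx, hxv⟩ := Finset.exists_mem_ne (by omega : 1 < (T.neighborFinset w).card) v
  rw [mem_neighborFinset] at hx
  have hN : T.neighborFinset w = {v, x} := by
    symm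
    apply Finset.eq_of_subset_of_card_le
    · intro y hy
      rw [Finset.mem_insert, Finset.mem_singleton] at hy
      rw [mem_neighborFinset]
      rcases hy with rfl | rfl
      · exact hvw.symm
      · exact hx
    · rw [hw, Finset.card_pair hxv.symm]
  have hsum := sum_card_branch hT w
  rw [hN, Finset.sum_pair hxv.symm] at hsum
  have hcard := card_branch_add_card_branch hT hvw
  have hsub : branch T w x ⊆ Finset.univ.filter fun y => y ≠ v ∧ ¬ T.Adj v y := by
    intro y hy
    have hy' := branch_subset hT hvw hx hxv hy
    rw [Finset.mem_filter]
    refine ⟨Finset.mem_univ _, ?_, fun hadj => ?_⟩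
    · rintro rfl
      exact notMem_branch_left _ _ hy'
    · obtain rfl := eq_of_mem_branch hT hvw hadj hy' (mem_branch_self hadj)
      exact notMem_branch_left _ _ hy
  have h1 := dissocCount_le_mul_two_pow T hsub
  have h2 := dissocCount_branch_le hT hx
  have h3 := treeWeight_le_of_three_le (by omega : 3 ≤ (branch T w x).card)
  have h5 := Finset.card_le_card hsub
  rw [card_not_adj] at h1 h5
  calc _ ≤ 16 * (dissocCount T (branch T w x) *
        2 ^ (Fintype.card V - 1 - T.degree v - (branch T w x).card)) := Nat.mul_le_mul_left _ h1
    _ = 16 * dissocCount T (branch T w x) *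
        2 ^ (Fintype.card V - 1 - T.degree v - (branch T w x).card) := by ring
    _ ≤ 14 * 2 ^ (branch T w x).card *
        2 ^ (Fintype.card V - 1 - T.degree v - (branch T w x).card) :=
        Nat.mul_le_mul_right _ (h2.trans (Nat.mul_le_mul_right _ h3))
    _ = _ := by
        rw [mul_assoc, ← pow_add, Nat.add_sub_cancel' h5]

theorem dissocNum_lt_hBound_of_degree_eq_two (hT : T.IsTree) {v : V}
    (hv : ∀ w, T.Adj v w → 2 * (branch T v w).card ≤ Fintype.card V)
    (hdeg : T.degree v = 2) (h9 : 9 ≤ Fintype.card V) (h10 : Fintype.card V ≤ 10) :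
    dissocNum T < hBound (Fintype.card V) := by
  have hN := hdeg
  rw [← card_neighborFinset_eq_degree, Finset.card_eq_two] at hN
  obtain ⟨w, w', hne, hN⟩ := hN
  have hw : T.Adj v w := by
    rw [← mem_neighborFinset, hN]
    simp
  have hw' : T.Adj v w' := by
    rw [← mem_neighborFinset, hN]
    simp
  have hsum := sum_card_branch hT v
  rw [hN, Finset.sum_pair hne] at hsum
  have hc := hv w hw
  have hc' := hv w' hw'
  have hA := dissocCount_biUnion_le T (T.neighborFinset v) (branch T v)
  rw [biUnion_branch hT, hN, Finset.prod_pair hne] at hA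
  have hb := dissocCount_branch_le hT hw
  have hb' := dissocCount_branch_le hT hw'
  have hd := two_le_degree_of_two_le_card_branch hT hw (by omega)
  have hd' := two_le_degree_of_two_le_card_branch hT hw' (by omega)
  have hB := dissocCount_le_two_pow T (Finset.univ.filter fun x => x ≠ v ∧ ¬ T.Adj v x)
  rw [card_not_adj, hdeg] at hB
  have hC := dissocCount_le_two_pow T
    (Finset.univ.filter fun x => ¬ T.Adj v x ∧ ¬ T.Adj w x)
  have hC' := dissocCount_le_two_pow T
    (Finset.univ.filter fun x => ¬ T.Adj v x ∧ ¬ T.Adj w' x)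
  rw [card_not_adj_not_adj hT hw, hdeg] at hC
  rw [card_not_adj_not_adj hT hw', hdeg] at hC'
  have hBC : dissocCount T (Finset.univ.filter fun x => ¬ T.Adj v x ∧ ¬ T.Adj w x) ≤
          2 ^ (Fintype.card V - 5) ∧
        dissocCount T (Finset.univ.filter fun x => ¬ T.Adj v x ∧ ¬ T.Adj w' x) ≤
          2 ^ (Fintype.card V - 5) ∨
      16 * dissocCount T (Finset.univ.filter fun x => x ≠ v ∧ ¬ T.Adj v x) ≤
          14 * 2 ^ (Fintype.card V - 1 - 2) ∧
        dissocCount T (Finset.univ.filter fun x => ¬ T.Adj v x ∧ ¬ T.Adj w x) ≤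
          2 ^ (Fintype.card V - 4) ∧
        dissocCount T (Finset.univ.filter fun x => ¬ T.Adj v x ∧ ¬ T.Adj w' x) ≤
          2 ^ (Fintype.card V - 4) := by
    by_cases h : 3 ≤ T.degree w ∧ 3 ≤ T.degree w'
    · exact Or.inl ⟨hC.trans (Nat.pow_le_pow_right two_pos (by omega)),
        hC'.trans (Nat.pow_le_pow_right two_pos (by omega))⟩
    · refine Or.inr ⟨?_, hC.trans (Nat.pow_le_pow_right two_pos (by omega)),
        hC'.trans (Nat.pow_le_pow_right two_pos (by omega))⟩
      have : T.degree w = 2 ∨ T.degree w' = 2 := by omega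
      rcases this with h | h
      · have := dissocCount_not_adj_le_of_degree_eq_two hT hw h (by omega)
        rwa [hdeg] at this
      · have := dissocCount_not_adj_le_of_degree_eq_two hT hw' h (by omega)
        rwa [hdeg] at this
  clear hC hC'
  rw [dissocNum_eq_hub T v, hN, Finset.sum_pair hne]
  have h9' : hBound 9 = 292 := by decide
  have h10' : hBound 10 = 556 := by decide
  have hsizes : (Fintype.card V = 9 ∧ (branch T v w).card = 4 ∧ (branch T v w').card = 4) ∨
      (Fintype.card V = 10 ∧ (branch T v w).card = 4 ∧ (branch T v w').card = 5) ∨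
      (Fintype.card V = 10 ∧ (branch T v w).card = 5 ∧ (branch T v w').card = 4) := by
    omega
  have hw4 : treeWeight 4 = 13 := rfl
  have hw5 : treeWeight 5 = 12 := rfl
  generalize dissocCount T (Finset.univ.filter fun x => x ≠ v ∧ ¬ T.Adj v x) = B at *
  generalize dissocCount T (Finset.univ.filter fun x => ¬ T.Adj v x ∧ ¬ T.Adj w x) = C at *
  generalize dissocCount T (Finset.univ.filter fun x => ¬ T.Adj v x ∧ ¬ T.Adj w' x) = C' at *
  rcases hsizes with ⟨h, h1, h2⟩ | ⟨h, h1, h2⟩ | ⟨h, h1, h2⟩ <;>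
    rw [h1] at hb <;> rw [h2] at hb' <;> rw [h] at hB hBC ⊢ <;>
    simp only [hw4, hw5] at hb hb' <;> norm_num at hb hb' hB hBC
  · have := Nat.mul_le_mul (by omega : dissocCount T (branch T v w) ≤ 13)
      (by omega : dissocCount T (branch T v w') ≤ 13)
    omega
  · have := Nat.mul_le_mul (by omega : dissocCount T (branch T v w) ≤ 13)
      (by omega : dissocCount T (branch T v w') ≤ 24)
    omega
  · have := Nat.mul_le_mul (by omega : dissocCount T (branch T v w) ≤ 24)
      (by omega : dissocCount T (branch T v w') ≤ 13)
    omega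

theorem dissocNum_lt_hBound (hT : T.IsTree) {v : V}
    (hv : ∀ w, T.Adj v w → 2 * (branch T v w).card ≤ Fintype.card V)
    (h3 : ∃ w, T.Adj v w ∧ 3 ≤ (branch T v w).card) (h9 : 9 ≤ Fintype.card V) :
    dissocNum T < hBound (Fintype.card V) := by
  by_cases h : T.degree v = 2 ∧ Fintype.card V ≤ 10
  · exact dissocNum_lt_hBound_of_degree_eq_two hT hv h.1 h9 h.2
  have hsum := sum_branchSizes hT v
  have hlt := hubWeight_lt (l := branchSizes T v) one_le_of_mem_branchSizes (by omega)
    (by rw [length_branchSizes]; omega)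
    (by
      obtain ⟨w, hw, hw3⟩ := h3
      exact ⟨_, mem_branchSizes.2 ⟨w, hw, rfl⟩, hw3⟩)
    (balanced_branchSizes hT hv)
  rw [length_branchSizes, hsum, Nat.sub_add_cancel (by omega)] at hlt
  exact lt_of_mul_lt_mul_right
    ((dissocNum_mul_le hT fun w hw => dissocCount_branch_le hT hw).trans_lt hlt) (Nat.zero_le _)

end LargeBranch

section StarGraph

theorem starGraph_adj_inl_inl {r : ℕ} {s : List ℕ} {a b : Fin (r + 1)} :
    (starGraph r s).Adj (Sum.inl a) (Sum.inl b) ↔ a ≠ b := by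
  simp [_root_.starGraph]

theorem starGraph_adj_inl_inr {r : ℕ} {s : List ℕ} {a : Fin (r + 1)} {i : Fin s.length}
    {j : Fin (s.get i + 1)} :
    (starGraph r s).Adj (Sum.inl a) (Sum.inr ⟨i, j⟩) ↔ a = 0 ∧ j = 0 := by
  simp only [_root_.starGraph, ne_eq, reduceCtorEq, not_false_eq_true, Sum.elim_inl, Sum.elim_inr,
    Sum.inl.injEq, Sum.inr.injEq, or_false, false_or, true_and, exists_false,
    and_false]
  refine and_congr_right fun _ => ⟨?_, fun h => ⟨i, by rw [h]⟩⟩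
  rintro ⟨i', h⟩
  obtain ⟨rfl, h⟩ := Sigma.mk.inj_iff.1 h
  exact eq_of_heq h

theorem starGraph_adj_inr_inl {r : ℕ} {s : List ℕ} {a : Fin (r + 1)} {i : Fin s.length}
    {j : Fin (s.get i + 1)} :
    (starGraph r s).Adj (Sum.inr ⟨i, j⟩) (Sum.inl a) ↔ a = 0 ∧ j = 0 := by
  rw [adj_comm, starGraph_adj_inl_inr]

theorem starGraph_adj_inr_inr {r : ℕ} {s : List ℕ} {p q : Σ i : Fin s.length, Fin (s.get i + 1)} :
    (starGraph r s).Adj (Sum.inr p) (Sum.inr q) ↔ p ≠ q ∧ p.1 = q.1 := by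
  simp [_root_.starGraph]

theorem card_starGraph (r : ℕ) (s : List ℕ) :
    Fintype.card (Fin (r + 1) ⊕ (Σ i : Fin s.length, Fin (s.get i + 1))) =
      r + 1 + (s.sum + s.length) := by
  rw [Fintype.card_sum, Fintype.card_sigma]
  simp only [Fintype.card_fin, Finset.sum_add_distrib, List.get_eq_getElem]
  simp [Fin.sum_univ_getElem]

/-- Splitting the hub edge `K₂` into the hub `K₁` and a pendant `K₁`. -/
theorem nonempty_starGraph_one_iso (l : List ℕ) :
    Nonempty (starGraph 0 (0 :: l) ≃g starGraph 1 l) := by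
  let f : Fin 2 ⊕ (Σ i : Fin l.length, Fin (l.get i + 1)) →
      Fin 1 ⊕ (Σ i : Fin (0 :: l).length, Fin ((0 :: l).get i + 1)) :=
    Sum.elim (fun a => if a = 0 then Sum.inl 0 else Sum.inr ⟨0, 0⟩)
      fun p => Sum.inr ⟨p.1.succ, p.2⟩
  have hf0 : f (Sum.inl 0) = Sum.inl 0 := rfl
  have hf1 : f (Sum.inl 1) = Sum.inr ⟨0, 0⟩ := rfl
  have hf2 : ∀ i j, f (Sum.inr ⟨i, j⟩) = Sum.inr ⟨i.succ, j⟩ := fun _ _ => rfl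
  have hsurj : f.Surjective := by
    rintro (a | ⟨i, j⟩)
    · exact ⟨Sum.inl 0, by rw [hf0, Subsingleton.elim a 0]⟩
    · induction i using Fin.cases with
      | zero =>
        have : j = 0 := Fin.ext (by have := j.isLt; simp at this; simpa using this)
        exact ⟨Sum.inl 1, by rw [hf1, this]⟩
      | succ i => exact ⟨Sum.inr ⟨i, j⟩, hf2 i j⟩
  have hbij : f.Bijective := by
    rw [Fintype.bijective_iff_surjective_and_card]
    refine ⟨hsurj, ?_⟩
    have h1 := card_starGraph 1 l
    have h2 := card_starGraph 0 (0 :: l)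
    rw [h1, h2, List.sum_cons, List.length_cons]
    omega
  refine ⟨(RelIso.mk (Equiv.ofBijective f hbij) ?_ : starGraph 1 l ≃g _).symm⟩
  have key : ∀ a : Fin 2, a = 0 ∨ a = 1 := by decide
  have hzero : ∀ i : Fin l.length, (0 : Fin (0 :: l).length) ≠ i.succ := fun i h =>
    Fin.succ_ne_zero i h.symm
  rintro (a | ⟨i, j⟩) (b | ⟨i', j'⟩)
  · rcases key a with rfl | rfl <;> rcases key b with rfl | rfl
    · exact iff_of_false (SimpleGraph.irrefl _) (SimpleGraph.irrefl _)
    · exact iff_of_true (starGraph_adj_inl_inr.2 ⟨rfl, rfl⟩)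
        (starGraph_adj_inl_inl.2 zero_ne_one)
    · exact iff_of_true (starGraph_adj_inr_inl.2 ⟨rfl, rfl⟩)
        (starGraph_adj_inl_inl.2 one_ne_zero)
    · exact iff_of_false (SimpleGraph.irrefl _) (SimpleGraph.irrefl _)
  · rcases key a with rfl | rfl
    · refine Iff.trans (starGraph_adj_inl_inr (s := 0 :: l) (i := i'.succ) (j := j')) ?_
      exact ⟨fun h => starGraph_adj_inl_inr.2 ⟨rfl, h.2⟩,
        fun h => ⟨rfl, (starGraph_adj_inl_inr.1 h).2⟩⟩
    · refine iff_of_false (fun h => ?_) fun h => ?_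
      · exact hzero i' (starGraph_adj_inr_inr.1 h).2
      · exact one_ne_zero (starGraph_adj_inl_inr.1 h).1
  · rcases key b with rfl | rfl
    · refine Iff.trans (starGraph_adj_inr_inl (s := 0 :: l) (i := i.succ) (j := j)) ?_
      exact ⟨fun h => starGraph_adj_inr_inl.2 ⟨rfl, h.2⟩,
        fun h => ⟨rfl, (starGraph_adj_inr_inl.1 h).2⟩⟩
    · refine iff_of_false (fun h => ?_) fun h => ?_
      · exact hzero i (starGraph_adj_inr_inr.1 h).2.symm
      · exact one_ne_zero (starGraph_adj_inr_inl.1 h).1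
  · refine Iff.trans
      (starGraph_adj_inr_inr (s := 0 :: l) (p := ⟨i.succ, j⟩) (q := ⟨i'.succ, j'⟩)) ?_
    refine Iff.trans ?_ starGraph_adj_inr_inr.symm
    refine and_congr (not_congr ⟨fun h => ?_, fun h => ?_⟩) (Fin.succ_injective _).eq_iff
    · have := hbij.1 (a₁ := Sum.inr ⟨i, j⟩) (a₂ := Sum.inr ⟨i', j'⟩) (congrArg Sum.inr h)
      exact Sum.inr_injective this
    · exact Sum.inr_injective (congrArg (fun p => f (Sum.inr p)) h)

open Classical in
theorem dissocNum_eq_of_iso_starGraph {V : Type*} [Fintype V] {T : SimpleGraph V} (hT : T.IsTree)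
    {l : List ℕ} (hl : ∀ s ∈ l, s ≤ 1) (e : T ≃g _root_.starGraph 0 l) :
    dissocNum T =
      2 ^ (l.sum + l.length) + 2 ^ l.sum + (l.map fun s => 2 ^ (l.sum - s)).sum := by
  have hcard : Fintype.card V = 1 + (l.sum + l.length) := by
    rw [Fintype.card_congr e.toEquiv, card_starGraph]
  obtain ⟨v, hv⟩ : ∃ v, e v = Sum.inl 0 := ⟨_, e.apply_symm_apply _⟩
  obtain ⟨u, hu⟩ : ∃ u : (i : Fin l.length) → Fin (l.get i + 1) → V,
      ∀ i j, e (u i j) = Sum.inr ⟨i, j⟩ := ⟨fun i j => e.symm (Sum.inr ⟨i, j⟩), by simp⟩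
  have hcases : ∀ x, x = v ∨ ∃ i j, x = u i j := by
    intro x
    rcases hx : e x with a | ⟨i, j⟩
    · exact Or.inl (e.injective (by rw [hx, hv, Subsingleton.elim (α := Fin 1) a 0]))
    · exact Or.inr ⟨i, j, e.injective (by rw [hx, hu])⟩
  have huv : ∀ i j, u i j ≠ v := by
    intro i j h
    have := hu i j
    rw [h, hv] at this
    simp at this
  have huinj : ∀ {i j i' j'}, u i j = u i' j' →
      (⟨i, j⟩ : Σ i : Fin l.length, Fin (l.get i + 1)) = ⟨i', j'⟩ := by
    intro i j i' j' h
    have := hu i j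
    rw [h, hu] at this
    exact (Sum.inr_injective this).symm
  have hadj0 : ∀ i j, T.Adj v (u i j) ↔ j = 0 := by
    intro i j
    rw [← e.map_adj_iff, hv, hu, starGraph_adj_inl_inr]
    simp
  have hadj1 : ∀ i j i' j', T.Adj (u i j) (u i' j') ↔
      (⟨i, j⟩ : Σ i : Fin l.length, Fin (l.get i + 1)) ≠ ⟨i', j'⟩ ∧ i = i' := by
    intro i j i' j'
    rw [← e.map_adj_iff, hu, hu, starGraph_adj_inr_inr]
  have hN : T.neighborFinset v = Finset.univ.image fun i => u i 0 := by
    ext x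
    rw [mem_neighborFinset, Finset.mem_image]
    constructor
    · intro h
      rcases hcases x with rfl | ⟨i, j, rfl⟩
      · exact (T.irrefl h).elim
      · exact ⟨i, Finset.mem_univ _, by rw [(hadj0 i j).1 h]⟩
    · rintro ⟨i, _, rfl⟩
      exact (hadj0 i 0).2 rfl
  have hinj0 : Function.Injective fun i => u i 0 := fun i i' h => congrArg Sigma.fst (huinj h)
  have hdeg : T.degree v = l.length := by
    rw [← card_neighborFinset_eq_degree, hN, Finset.card_image_of_injective _ hinj0]
    simp
  have hdeg' : ∀ i, T.degree (u i 0) = l.get i + 1 := by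
    intro i
    have hNi : T.neighborFinset (u i 0) = insert v ((Finset.univ.erase 0).image (u i)) := by
      ext x
      rw [mem_neighborFinset, Finset.mem_insert, Finset.mem_image]
      constructor
      · intro h
        rcases hcases x with rfl | ⟨i', j, rfl⟩
        · exact Or.inl rfl
        · obtain ⟨h1, rfl⟩ := (hadj1 _ _ _ _).1 h
          refine Or.inr ⟨j, ?_, rfl⟩
          rw [Finset.mem_erase]
          refine ⟨?_, Finset.mem_univ _⟩
          rintro rfl
          exact h1 rfl
      · rintro (rfl | ⟨j, hj, rfl⟩)
        · exact ((hadj0 i 0).2 rfl).symm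
        · refine (hadj1 _ _ _ _).2 ⟨fun h => ?_, rfl⟩
          exact (Finset.mem_erase.1 hj).1 (eq_of_heq (Sigma.mk.inj_iff.1 h).2).symm
    have hinj : Function.Injective (u i) := fun j j' h =>
      eq_of_heq (Sigma.mk.inj_iff.1 (huinj h)).2
    rw [← card_neighborFinset_eq_degree, hNi, Finset.card_insert_of_notMem,
      Finset.card_image_of_injective _ hinj, Finset.card_erase_of_mem (Finset.mem_univ _)]
    · simp
    · intro h
      obtain ⟨j, _, hj⟩ := Finset.mem_image.1 h
      exact huv _ _ hj
  have hdis : IsDissociation T ((Finset.univ.erase v : Finset V) : Set V) := by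
    rintro x hx y ⟨hxy, hy⟩ z ⟨hxz, hz⟩
    rw [Finset.coe_erase, Finset.coe_univ] at hx hy hz
    obtain ⟨i, j, rfl⟩ := (hcases x).resolve_left hx.2
    obtain ⟨i', j', rfl⟩ := (hcases y).resolve_left hy.2
    obtain ⟨i'', j'', rfl⟩ := (hcases z).resolve_left hz.2
    obtain ⟨h1, rfl⟩ := (hadj1 _ _ _ _).1 hxy
    obtain ⟨h2, rfl⟩ := (hadj1 _ _ _ _).1 hxz
    have h1 : j ≠ j' := fun h => h1 (by rw [h])
    have h2 : j ≠ j'' := fun h => h2 (by rw [h])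
    have hli := hl _ (List.get_mem l i)
    have : j' = j'' := by omega
    rw [this]
  rw [dissocNum_eq_hub T v, dissocCount_eq_two_pow hdis, dissocCount_eq_two_pow (hdis.mono ?_),
    card_not_adj, hdeg, Finset.card_erase_of_mem (Finset.mem_univ _), Finset.card_univ, hcard, hN,
    Finset.sum_image fun _ _ _ _ h => hinj0 h, ← Fin.sum_univ_fun_getElem]
  · congr 1
    · congr 2 <;> omega
    · refine Finset.sum_congr rfl fun i _ => ?_
      have hvi : T.Adj v (u i 0) := (hadj0 i 0).2 rfl
      rw [dissocCount_eq_two_pow (hdis.mono ?_), card_not_adj_not_adj hT hvi, hdeg, hdeg', hcard]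
      · congr 1
        rw [List.get_eq_getElem]
        omega
      · intro x hx
        rw [Finset.mem_coe, Finset.mem_filter] at hx
        rw [Finset.mem_coe, Finset.mem_erase]
        refine ⟨?_, Finset.mem_univ _⟩
        rintro rfl
        exact hx.2.2 hvi.symm
  · intro x hx
    rw [Finset.mem_coe, Finset.mem_filter] at hx
    exact Finset.mem_coe.2 (Finset.mem_erase.2 ⟨hx.2.1, hx.1⟩)

end StarGraph

section Spider

open Classical

variable {V : Type*} [Fintype V] {T : SimpleGraph V}

theorem nonempty_iso_starGraph (hT : T.IsTree) {v : V} {l : List ℕ} (hl : ∀ s ∈ l, s ≤ 1)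
    {w : Fin l.length → V} (hw : Function.Injective w) (hN : ∀ x, T.Adj v x ↔ ∃ i, w i = x)
    (hc : ∀ i, (branch T v (w i)).card = l.get i + 1) :
    Nonempty (T ≃g _root_.starGraph 0 l) := by
  have hvw : ∀ i, T.Adj v (w i) := fun i => (hN _).2 ⟨i, rfl⟩
  have hex : ∀ i, ∃ x, l.get i = 1 → T.Adj (w i) x ∧ x ≠ v := by
    intro i
    by_cases h : l.get i = 1
    · have h2 := two_le_degree_of_two_le_card_branch hT (hvw i) (by rw [hc, h])
      rw [← card_neighborFinset_eq_degree] at h2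
      obtain ⟨x, hx, hxv⟩ := Finset.exists_mem_ne h2 v
      exact ⟨x, fun _ => ⟨(mem_neighborFinset _ _ _).1 hx, hxv⟩⟩
    · exact ⟨v, fun h' => (h h').elim⟩
  choose o ho using hex
  have hone : ∀ i (j : Fin (l.get i + 1)), j ≠ 0 → l.get i = 1 ∧ (j : ℕ) = 1 := by
    intro i j hj
    have h1 := hl _ (List.get_mem l i)
    have h2 := j.isLt
    have h3 : (j : ℕ) ≠ 0 := fun h => hj (Fin.ext h)
    omega
  let u : (i : Fin l.length) → Fin (l.get i + 1) → V := fun i j => if j = 0 then w i else o i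
  have hu0 : ∀ i, u i 0 = w i := fun i => if_pos rfl
  have hu1 : ∀ i j, j ≠ 0 → u i j = o i := fun i j hj => if_neg hj
  have humem : ∀ i j, u i j ∈ branch T v (w i) := by
    intro i j
    by_cases hj : j = 0
    · rw [hj, hu0]
      exact mem_branch_self (hvw i)
    · obtain ⟨h1, h2⟩ := ho i (hone i j hj).1
      rw [hu1 i j hj]
      exact mem_branch_of_adj hT (hvw i) h1 h2 (mem_branch_self (hvw i))
  have huv : ∀ i j, u i j ≠ v := fun i j h =>
    notMem_branch_left (T := T) v (w i) (h ▸ humem i j)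
  have huadj : ∀ i j j', j ≠ j' → T.Adj (u i j) (u i j') := by
    have : ∀ i j, j ≠ 0 → T.Adj (w i) (u i j) := fun i j hj => by
      rw [hu1 i j hj]
      exact (ho i (hone i j hj).1).1
    intro i j j' h
    by_cases hj : j = 0
    · subst hj
      rw [hu0]
      exact this i j' h.symm
    by_cases hj' : j' = 0
    · subst hj'
      rw [hu0]
      exact (this i j hj).symm
    · exact (h (Fin.ext (by rw [(hone i j hj).2, (hone i j' hj').2]))).elim
  let f : Fin 1 ⊕ (Σ i : Fin l.length, Fin (l.get i + 1)) → V :=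
    Sum.elim (fun _ => v) fun p => u p.1 p.2
  have hf : f.Injective := by
    rintro (a | ⟨i, j⟩) (b | ⟨i', j'⟩) h
    · rw [Subsingleton.elim a b]
    · exact (huv i' j' h.symm).elim
    · exact (huv i j h).elim
    · have h : u i j = u i' j' := h
      obtain rfl : i = i' := hw
        (eq_of_mem_branch hT (hvw i) (hvw i') (humem i j) (h ▸ humem i' j'))
      by_contra hne
      exact (huadj i j j' fun hj => hne (by rw [hj])).ne h
  have hcard : Fintype.card V =
      Fintype.card (Fin 1 ⊕ (Σ i : Fin l.length, Fin (l.get i + 1))) := by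
    have h1 := sum_card_branch hT v
    have h2 : T.neighborFinset v = Finset.univ.image w := by
      ext x
      rw [mem_neighborFinset, hN]
      simp
    rw [h2, Finset.sum_image fun _ _ _ _ h => hw h, Finset.sum_congr rfl fun i _ => hc i,
      Finset.sum_add_distrib] at h1
    simp only [List.get_eq_getElem, Fin.sum_univ_getElem, Finset.sum_const, Finset.card_univ,
      Fintype.card_fin, smul_eq_mul, mul_one] at h1
    have := Fintype.card_pos_iff.2 ⟨v⟩
    have h3 := card_starGraph 0 l
    rw [zero_add] at h3
    rw [h3]
    omega
  have hbij : f.Bijective := (Fintype.bijective_iff_injective_and_card f).2 ⟨hf, hcard.symm⟩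
  refine ⟨(RelIso.mk (Equiv.ofBijective f hbij) ?_ : _root_.starGraph 0 l ≃g T).symm⟩
  have hvu : ∀ i j, T.Adj v (u i j) ↔ j = 0 := by
    intro i j
    constructor
    · intro h
      by_contra hj
      exact hT.not_adj_of_adj_of_adj (hvw i) h (hu0 i ▸ huadj i 0 j (Ne.symm hj))
    · rintro rfl
      rw [hu0]
      exact hvw i
  rintro (a | ⟨i, j⟩) (b | ⟨i', j'⟩)
  · refine iff_of_false (T.irrefl) fun h => starGraph_adj_inl_inl.1 h ?_
    exact Subsingleton.elim (α := Fin 1) a b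
  · refine (hvu i' j').trans ⟨fun h => ?_, fun h => (starGraph_adj_inl_inr.1 h).2⟩
    exact starGraph_adj_inl_inr.2 ⟨Subsingleton.elim (α := Fin 1) a 0, h⟩
  · refine (T.adj_comm _ _).trans ((hvu i j).trans ⟨fun h => ?_, fun h => ?_⟩)
    · exact starGraph_adj_inr_inl.2 ⟨Subsingleton.elim (α := Fin 1) b 0, h⟩
    · exact (starGraph_adj_inr_inl.1 h).2
  · refine Iff.trans ?_ starGraph_adj_inr_inr.symm
    constructor
    · intro h
      have h : T.Adj (u i j) (u i' j') := h
      refine ⟨fun heq => h.ne ?_, ?_⟩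
      · exact congrArg (fun p : Σ i : Fin l.length, Fin (l.get i + 1) => u p.1 p.2) heq
      · exact hw (eq_of_mem_branch hT (hvw i) (hvw i')
          (mem_branch_of_adj hT (hvw i) h (huv i' j') (humem i j)) (humem i' j'))
    · rintro ⟨h1, h2⟩
      obtain rfl : i = i' := h2
      exact huadj i j j' fun h => h1 (by rw [h])

theorem exists_iso_starGraph_replicate (hT : T.IsTree) {v : V}
    (hv : ∀ w, T.Adj v w → (branch T v w).card ≤ 2) :
    ∃ a b, Nonempty (T ≃g _root_.starGraph 0 (List.replicate a 0 ++ List.replicate b 1)) := by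
  let A := (T.neighborFinset v).filter fun w => (branch T v w).card = 1
  let B := (T.neighborFinset v).filter fun w => (branch T v w).card = 2
  refine ⟨A.card, B.card, ?_⟩
  set l := List.replicate A.card 0 ++ List.replicate B.card 1 with hl
  have hLlen : l.length = (A.toList ++ B.toList).length := by simp [hl]
  have hmap : (A.toList ++ B.toList).map (fun w => (branch T v w).card) =
      l.map (· + 1) := by
    rw [hl, List.map_append, List.map_append, List.map_replicate, List.map_replicate]
    congr 1
    · rw [List.eq_replicate_iff]
      refine ⟨by simp, fun s hs => ?_⟩
      obtain ⟨w, hw, rfl⟩ := List.mem_map.1 hs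
      exact (Finset.mem_filter.1 (Finset.mem_toList.1 hw)).2
    · rw [List.eq_replicate_iff]
      refine ⟨by simp, fun s hs => ?_⟩
      obtain ⟨w, hw, rfl⟩ := List.mem_map.1 hs
      exact (Finset.mem_filter.1 (Finset.mem_toList.1 hw)).2
  have hnd : (A.toList ++ B.toList).Nodup := by
    refine (Finset.nodup_toList A).append (Finset.nodup_toList B) fun w h1 h2 => ?_
    have h1 := (Finset.mem_filter.1 (Finset.mem_toList.1 h1)).2
    have h2 := (Finset.mem_filter.1 (Finset.mem_toList.1 h2)).2
    omega
  refine nonempty_iso_starGraph (v := v) hT ?_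
    (w := fun i => (A.toList ++ B.toList).get (i.cast hLlen)) ?_ ?_ ?_
  · intro s hs
    rw [hl, List.mem_append, List.mem_replicate, List.mem_replicate] at hs
    omega
  · intro i j h
    have := hnd.injective_get h
    exact Fin.cast_injective _ this
  · intro x
    have hx : x ∈ A.toList ++ B.toList ↔ T.Adj v x := by
      rw [List.mem_append, Finset.mem_toList, Finset.mem_toList, Finset.mem_filter,
        Finset.mem_filter, mem_neighborFinset]
      refine ⟨fun h => h.elim And.left And.left, fun h => ?_⟩
      have h1 := hv x h
      have h2 : 0 < (branch T v x).card := Finset.card_pos.2 ⟨x, mem_branch_self h⟩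
      have : (branch T v x).card = 1 ∨ (branch T v x).card = 2 := by omega
      exact this.imp (fun h' => ⟨h, h'⟩) fun h' => ⟨h, h'⟩
    rw [← hx, List.mem_iff_get]
    constructor
    · rintro ⟨i, hi⟩
      exact ⟨i.cast hLlen.symm, hi⟩
    · rintro ⟨i, hi⟩
      exact ⟨_, hi⟩
  · intro i
    have h1 : ((A.toList ++ B.toList).map fun w => (branch T v w).card)[(i : ℕ)]'(by
        rw [List.length_map, ← hLlen]; exact i.isLt) = (l.map (· + 1))[(i : ℕ)]'(by
        rw [List.length_map]; exact i.isLt) := by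
      congr 1
    rw [List.getElem_map, List.getElem_map] at h1
    exact h1

theorem dissocNum_eq_of_iso_replicate (hT : T.IsTree) {a b : ℕ}
    (e : T ≃g _root_.starGraph 0 (List.replicate a 0 ++ List.replicate b 1)) :
    dissocNum T = 2 ^ (a + 2 * b) + 2 ^ b + a * 2 ^ b + b * 2 ^ (b - 1) := by
  rw [dissocNum_eq_of_iso_starGraph hT ?_ e]
  · simp only [List.sum_append, List.sum_replicate, List.length_append, List.length_replicate,
      List.map_append, List.map_replicate, smul_eq_mul, mul_zero, mul_one, zero_add, Nat.sub_zero]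
    rw [show b + (a + b) = a + 2 * b by ring]
    ring
  · intro s hs
    rw [List.mem_append, List.mem_replicate, List.mem_replicate] at hs
    omega

theorem card_eq_of_iso_replicate {a b : ℕ}
    (e : T ≃g _root_.starGraph 0 (List.replicate a 0 ++ List.replicate b 1)) :
    Fintype.card V = 1 + a + 2 * b := by
  rw [Fintype.card_congr e.toEquiv, card_starGraph]
  simp
  ring

end Spider

section Extremal

theorem two_pow_mul_lt_two_pow_add_mul {b c k : ℕ} (hc : 6 ≤ c) (hk : 1 ≤ k) :
    2 ^ b * (c + 4 * k + b) < 2 ^ (b + k) * (b + k + c) := by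
  have h1 : k + 1 ≤ 2 ^ k := Nat.lt_two_pow_self
  rw [pow_add, mul_assoc]
  refine Nat.mul_lt_mul_of_pos_left ?_ (by positivity)
  refine lt_of_lt_of_le ?_ (Nat.mul_le_mul_right _ h1)
  nlinarith

theorem hBound_odd (m : ℕ) : hBound (2 * m + 7) = 2 ^ (2 * m + 6) + (2 * m + 16) * 2 ^ m := by
  rw [hBound, if_pos ⟨m + 3, by ring⟩]
  rw [show (2 * m + 7 - 7) / 2 = m by omega]
  rfl

theorem hBound_even (m : ℕ) : hBound (2 * m + 8) = 2 ^ (2 * m + 7) + (2 * m + 20) * 2 ^ m := by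
  rw [hBound, if_neg (by rw [Nat.not_odd_iff_even]; exact ⟨m + 4, by ring⟩)]
  rw [show (2 * m + 8 - 8) / 2 = m by omega]
  rfl

theorem spider_le_hBound {a b : ℕ} (ha : 2 ≤ a) (h9 : 9 ≤ 1 + a + 2 * b) :
    2 ^ (a + 2 * b) + 2 ^ b + a * 2 ^ b + b * 2 ^ (b - 1) ≤ hBound (1 + a + 2 * b) ∧
    (2 ^ (a + 2 * b) + 2 ^ b + a * 2 ^ b + b * 2 ^ (b - 1) = hBound (1 + a + 2 * b) ↔ a ≤ 3) := by
  have hb : 2 * (b * 2 ^ (b - 1)) = b * 2 ^ b := by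
    cases b with
    | zero => simp
    | succ b =>
      rw [Nat.add_sub_cancel, pow_succ]
      ring
  obtain ⟨k, hk⟩ : ∃ k, a = 2 + 2 * k ∨ a = 3 + 2 * k := ⟨(a - 2) / 2, by omega⟩
  obtain ⟨m, hm⟩ : ∃ m, b + k = m + 2 := ⟨b + k - 2, by omega⟩
  have hpow : 2 ^ (b + k) = 4 * 2 ^ m := by
    rw [hm, pow_add]
    ring
  have hmul : 2 ^ (b + k) * (b + k) = 4 * (2 ^ m * (m + 2)) := by
    rw [hpow, hm]
    ring
  rcases hk with rfl | rfl
  · rw [show 1 + (2 + 2 * k) + 2 * b = 2 * m + 7 by omega,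
      show 2 + 2 * k + 2 * b = 2 * m + 6 by omega, hBound_odd]
    rcases Nat.eq_zero_or_pos k with rfl | hk
    · rw [add_zero] at hpow hmul
      have : 2 ^ (2 * m + 6) + 2 ^ b + (2 + 2 * 0) * 2 ^ b + b * 2 ^ (b - 1) =
          2 ^ (2 * m + 6) + (2 * m + 16) * 2 ^ m := by
        nlinarith
      exact ⟨this.le, iff_of_true this (by norm_num)⟩
    · have h := two_pow_mul_lt_two_pow_add_mul (b := b) (le_refl 6) hk
      have : 2 ^ (2 * m + 6) + 2 ^ b + (2 + 2 * k) * 2 ^ b + b * 2 ^ (b - 1) <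
          2 ^ (2 * m + 6) + (2 * m + 16) * 2 ^ m := by
        nlinarith
      exact ⟨this.le, iff_of_false this.ne (by omega)⟩
  · rw [show 1 + (3 + 2 * k) + 2 * b = 2 * m + 8 by omega,
      show 3 + 2 * k + 2 * b = 2 * m + 7 by omega, hBound_even]
    rcases Nat.eq_zero_or_pos k with rfl | hk
    · rw [add_zero] at hpow hmul
      have : 2 ^ (2 * m + 7) + 2 ^ b + (3 + 2 * 0) * 2 ^ b + b * 2 ^ (b - 1) =
          2 ^ (2 * m + 7) + (2 * m + 20) * 2 ^ m := by
        nlinarith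
      exact ⟨this.le, iff_of_true this (by norm_num)⟩
    · have h := two_pow_mul_lt_two_pow_add_mul (b := b) (by norm_num : 6 ≤ 8) hk
      have : 2 ^ (2 * m + 7) + 2 ^ b + (3 + 2 * k) * 2 ^ b + b * 2 ^ (b - 1) <
          2 ^ (2 * m + 7) + (2 * m + 20) * 2 ^ m := by
        nlinarith
      exact ⟨this.le, iff_of_false this.ne (by omega)⟩

variable {V : Type*} [Fintype V] {T : SimpleGraph V}

theorem isTGraph_iff {n : ℕ} (hn : Fintype.card V = n) : IsTGraph n T ↔
    ∃ a b, 2 ≤ a ∧ a ≤ 3 ∧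
      Nonempty (T ≃g _root_.starGraph 0 (List.replicate a 0 ++ List.replicate b 1)) := by
  rw [IsTGraph]
  constructor
  · intro h
    split_ifs at h
    · exact ⟨2, _, le_rfl, by norm_num, h⟩
    · exact ⟨3, _, by norm_num, le_rfl, h⟩
  · rintro ⟨a, b, h2, h3, ⟨e⟩⟩
    have hcard := card_eq_of_iso_replicate e
    rw [hn] at hcard
    split_ifs with hodd
    · rw [Nat.odd_iff] at hodd
      obtain rfl : a = 2 := by omega
      rw [show (n - 3) / 2 = b by omega]
      exact ⟨e⟩
    · rw [Nat.odd_iff] at hodd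
      obtain rfl : a = 3 := by omega
      rw [show (n - 4) / 2 = b by omega]
      exact ⟨e⟩

theorem isFGraph_of_iso_replicate {n a b : ℕ} (hn : Fintype.card V = n) (ha : a ≤ 1)
    (e : T ≃g _root_.starGraph 0 (List.replicate a 0 ++ List.replicate b 1)) :
    IsFGraph n T := by
  have hcard := card_eq_of_iso_replicate e
  rw [hn] at hcard
  rw [IsFGraph]
  split_ifs with hodd
  · rw [Nat.odd_iff] at hodd
    obtain rfl : a = 0 := by omega
    rw [show (n - 1) / 2 = b by omega]
    exact ⟨e⟩
  · rw [Nat.odd_iff] at hodd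
    obtain rfl : a = 1 := by omega
    rw [show (n - 2) / 2 = b by omega]
    obtain ⟨e'⟩ := nonempty_starGraph_one_iso (List.replicate b 1)
    exact ⟨e.trans e'⟩

end Extremal

/-- A tree of order `n ≥ 9` not isomorphic to `F_n` has at most `h(n)` dissociation
sets, with equality iff it is isomorphic to `T_n`. -/
theorem tree_second_largest {V : Type*} [Fintype V] (T : SimpleGraph V) (n : ℕ)
    (hn : Fintype.card V = n) (h9 : 9 ≤ n) (hT : T.IsTree) (hnF : ¬ IsFGraph n T) :
    dissocNum T ≤ hBound n ∧ (dissocNum T = hBound n ↔ IsTGraph n T) := by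
  have hequality : IsTGraph n T → dissocNum T = hBound n := by
    rw [isTGraph_iff hn]
    rintro ⟨a, b, h2, h3, ⟨e⟩⟩
    have hcard := card_eq_of_iso_replicate e
    rw [hn] at hcard
    rw [dissocNum_eq_of_iso_replicate hT e, hcard]
    exact (spider_le_hBound h2 (by omega)).2.2 h3
  obtain ⟨v, hv⟩ := exists_centroid hT
  by_cases h3 : ∃ w, T.Adj v w ∧ 3 ≤ (branch T v w).card
  · have hlt := dissocNum_lt_hBound hT hv h3 (by omega)
    rw [hn] at hlt
    exact ⟨hlt.le, fun h => (hlt.ne h).elim, hequality⟩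
  · push Not at h3
    obtain ⟨a, b, ⟨e⟩⟩ := exists_iso_starGraph_replicate hT fun w hw =>
      Nat.le_of_lt_succ (h3 w hw)
    have hcard := card_eq_of_iso_replicate e
    rw [hn] at hcard
    have ha : 2 ≤ a := by
      by_contra h
      exact hnF (isFGraph_of_iso_replicate hn (by omega) e)
    have hd := dissocNum_eq_of_iso_replicate hT e
    obtain ⟨hle, heq⟩ := spider_le_hBound ha (by omega : 9 ≤ 1 + a + 2 * b)
    rw [← hd, ← hcard] at hle heq
    exact ⟨hle, fun h => (isTGraph_iff hn).2 ⟨a, b, ha, heq.1 h, ⟨e⟩⟩, hequality⟩
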